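/- arXiv:1201.2089 — 2 statements merged into one kernel-verified Lean document; each statement's English description precedes it below -/
import Mathlib

section
/- Let g be a 2-inner product on a real vector space V. Then for all e₁, e₂, e₃ ∈ V and all real numbers α₁, α₂, α₃, β₁, β₂, β₃, γ₁, γ₂, γ₃ the following hold: (a) g(α₁e₁+α₂e₂, β₁e₁+β₂e₂ / γ₁e₁+γ₂e₂) = (α₁γ₂−α₂γ₁)·(β₁γ₂−β₂γ₁)·g(e₁,e₁/e₂); (b) g(Σᵢ₌₁³ αᵢeᵢ, Σᵢ₌₁³ βᵢeᵢ / Σᵢ₌₁³ γᵢeᵢ) = (1/2)·Σ over pairs i,j ∈ {1,2,3} with i ≠ j of (αᵢγⱼ−αⱼγᵢ)·(βᵢγⱼ−βⱼγᵢ)·g(eᵢ,eᵢ/eⱼ), plus Σ over triples i,j,k ∈ {1,2,3} pairwise distinct of (αᵢγₖ−αₖγᵢ)·(βⱼγₖ−βₖγⱼ)·g(eᵢ,eⱼ/eₖ). -/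
/-- A 2-inner product on a real vector space `V`: a map `g : V × V × V → ℝ`,
written `g u v w` for `g(u,v/w)`, satisfying the axioms of Diminnie–Gähler–White. -/
structure Is2InnerProduct (V : Type*) [AddCommGroup V] [Module ℝ V]
    (g : V → V → V → ℝ) : Prop where
  nonneg : ∀ u v : V, 0 ≤ g u u v
  eq_zero_iff : ∀ u v : V, g u u v = 0 ↔ ¬ LinearIndependent ℝ ![u, v]
  symm_swap : ∀ u v : V, g u u v = g v v u
  symm_left : ∀ u v w : V, g u v w = g v u w
  smul_add_left : ∀ (α : ℝ) (u u' v w : V),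
    g (α • u + u') v w = α * g u v w + g u' v w

namespace Is2InnerProduct

variable {V : Type*} [AddCommGroup V] [Module ℝ V] {g : V → V → V → ℝ}

theorem add_left (hg : Is2InnerProduct V g) (u u' v w : V) :
    g (u + u') v w = g u v w + g u' v w := by
  simpa using hg.smul_add_left 1 u u' v w

theorem zero_left (hg : Is2InnerProduct V g) (v w : V) : g 0 v w = 0 := by
  simpa using hg.add_left 0 0 v w

theorem smul_left (hg : Is2InnerProduct V g) (a : ℝ) (u v w : V) :
    g (a • u) v w = a * g u v w := by
  simpa [hg.zero_left] using hg.smul_add_left a u 0 v w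

theorem add_right (hg : Is2InnerProduct V g) (u v v' w : V) :
    g u (v + v') w = g u v w + g u v' w := by
  rw [hg.symm_left, hg.add_left, hg.symm_left v, hg.symm_left v']

theorem smul_right (hg : Is2InnerProduct V g) (a : ℝ) (u v w : V) :
    g u (a • v) w = a * g u v w := by
  rw [hg.symm_left, hg.smul_left, hg.symm_left v]

theorem self_self (hg : Is2InnerProduct V g) (w : V) : g w w w = 0 := by
  rw [hg.eq_zero_iff, LinearIndependent.pair_iff]
  intro h
  simpa using h 1 (-1) (by simp)

theorem self_left (hg : Is2InnerProduct V g) (w v : V) : g w v w = 0 := by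
  have key (t : ℝ) : 0 ≤ g v v w + 2 * t * g w v w := by
    have h := hg.nonneg (v + t • w) w
    simp only [hg.add_left, hg.add_right, hg.smul_left, hg.smul_right, hg.self_self,
      hg.symm_left v w] at h
    linarith
  by_contra hne
  have h := key (-(g v v w + 1) / (2 * g w v w))
  field_simp at h
  linarith

theorem self_right (hg : Is2InnerProduct V g) (w v : V) : g v w w = 0 := by
  rw [hg.symm_left, hg.self_left]

end Is2InnerProduct

/-- The polarization of `g u v w` in its last argument. -/
noncomputable def polarTwoInner {V : Type*} [AddCommGroup V] (g : V → V → V → ℝ)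
    (u v w z : V) : ℝ :=
  (g u v (w + z) - g u v w - g u v z) / 2

namespace Is2InnerProduct

variable {V : Type*} [AddCommGroup V] [Module ℝ V] {g : V → V → V → ℝ}

theorem polar_symm_left (hg : Is2InnerProduct V g) (u v w z : V) :
    polarTwoInner g u v w z = polarTwoInner g v u w z := by
  simp only [polarTwoInner, hg.symm_left u v]

theorem polar_add (hg : Is2InnerProduct V g) (u u' v w z : V) :
    polarTwoInner g (u + u') v w z = polarTwoInner g u v w z + polarTwoInner g u' v w z := by
  simp only [polarTwoInner, hg.add_left]
  ring

theorem polar_smul (hg : Is2InnerProduct V g) (a : ℝ) (u v w z : V) :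
    polarTwoInner g (a • u) v w z = a * polarTwoInner g u v w z := by
  simp only [polarTwoInner, hg.smul_left]
  ring

theorem polar_self_left (hg : Is2InnerProduct V g) (u w z : V) :
    polarTwoInner g u u w z = g w z u := by
  simp only [polarTwoInner, hg.symm_swap u, hg.add_left, hg.add_right, hg.symm_left z w]
  ring

theorem polar_swap (hg : Is2InnerProduct V g) (u v w z : V) :
    polarTwoInner g u v w z = polarTwoInner g w z u v := by
  have h := hg.polar_self_left (u + v) w z
  rw [hg.polar_add, hg.polar_symm_left u, hg.polar_symm_left v (u + v), hg.polar_add,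
    hg.polar_add, hg.polar_self_left, hg.polar_self_left, hg.polar_symm_left v u] at h
  rw [polarTwoInner.eq_def g w z, ← h]
  ring

theorem polar_symm_right (hg : Is2InnerProduct V g) (u v w z : V) :
    polarTwoInner g u v w z = polarTwoInner g u v z w := by
  rw [hg.polar_swap, hg.polar_symm_left, hg.polar_swap]

theorem polar_self_right (hg : Is2InnerProduct V g) (u v w : V) :
    polarTwoInner g u v w w = g u v w := by
  rw [hg.polar_swap, hg.polar_self_left]

theorem polar_add₂ (hg : Is2InnerProduct V g) (u v v' w z : V) :
    polarTwoInner g u (v + v') w z = polarTwoInner g u v w z + polarTwoInner g u v' w z := by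
  simp only [hg.polar_symm_left u, hg.polar_add]

theorem polar_smul₂ (hg : Is2InnerProduct V g) (a : ℝ) (u v w z : V) :
    polarTwoInner g u (a • v) w z = a * polarTwoInner g u v w z := by
  simp only [hg.polar_symm_left u, hg.polar_smul]

theorem polar_add₃ (hg : Is2InnerProduct V g) (u v w w' z : V) :
    polarTwoInner g u v (w + w') z = polarTwoInner g u v w z + polarTwoInner g u v w' z := by
  simp only [hg.polar_swap u v, hg.polar_add]

theorem polar_smul₃ (hg : Is2InnerProduct V g) (a : ℝ) (u v w z : V) :
    polarTwoInner g u v (a • w) z = a * polarTwoInner g u v w z := by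
  simp only [hg.polar_swap u v, hg.polar_smul]

theorem polar_add₄ (hg : Is2InnerProduct V g) (u v w z z' : V) :
    polarTwoInner g u v w (z + z') = polarTwoInner g u v w z + polarTwoInner g u v w z' := by
  simp only [hg.polar_swap u v, hg.polar_add₂]

theorem polar_smul₄ (hg : Is2InnerProduct V g) (a : ℝ) (u v w z : V) :
    polarTwoInner g u v w (a • z) = a * polarTwoInner g u v w z := by
  simp only [hg.polar_swap u v, hg.polar_smul₂]

theorem polar_cross₁₃ (hg : Is2InnerProduct V g) (u v w : V) :
    polarTwoInner g u v u w = -(1 / 2) * g v w u := by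
  have h (t : ℝ) : polarTwoInner g (u + t • w) v (u + t • w) (u + t • w) = 0 := by
    rw [hg.polar_self_right, hg.self_left]
  have h₁ := h 1
  have h₂ := h (-1)
  simp only [hg.polar_add, hg.polar_smul, hg.polar_add₃, hg.polar_smul₃, hg.polar_add₄,
    hg.polar_smul₄, hg.polar_self_right, hg.self_left, hg.polar_symm_right u v w u,
    hg.polar_symm_right w v w u] at h₁ h₂
  rw [hg.symm_left v w]
  linarith

theorem polar_cross₁₄ (hg : Is2InnerProduct V g) (u v w : V) :
    polarTwoInner g u v w u = -(1 / 2) * g v w u := by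
  rw [hg.polar_symm_right, hg.polar_cross₁₃]

theorem polar_cross₂₃ (hg : Is2InnerProduct V g) (u v w : V) :
    polarTwoInner g v u u w = -(1 / 2) * g v w u := by
  rw [hg.polar_symm_left, hg.polar_cross₁₃]

theorem polar_cross₂₄ (hg : Is2InnerProduct V g) (u v w : V) :
    polarTwoInner g v u w u = -(1 / 2) * g v w u := by
  rw [hg.polar_symm_left, hg.polar_cross₁₄]

theorem expand_three (hg : Is2InnerProduct V g) (x y z : V)
    (a₁ a₂ a₃ b₁ b₂ b₃ c₁ c₂ c₃ : ℝ) :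
    g (a₁ • x + a₂ • y + a₃ • z) (b₁ • x + b₂ • y + b₃ • z) (c₁ • x + c₂ • y + c₃ • z) =
      (a₁ * c₂ - a₂ * c₁) * (b₁ * c₂ - b₂ * c₁) * g x x y +
      (a₁ * c₃ - a₃ * c₁) * (b₁ * c₃ - b₃ * c₁) * g x x z +
      (a₂ * c₃ - a₃ * c₂) * (b₂ * c₃ - b₃ * c₂) * g y y z +
      ((a₁ * c₃ - a₃ * c₁) * (b₂ * c₃ - b₃ * c₂) +
        (a₂ * c₃ - a₃ * c₂) * (b₁ * c₃ - b₃ * c₁)) * g x y z +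
      ((a₁ * c₂ - a₂ * c₁) * (b₃ * c₂ - b₂ * c₃) +
        (a₃ * c₂ - a₂ * c₃) * (b₁ * c₂ - b₂ * c₁)) * g x z y +
      ((a₂ * c₁ - a₁ * c₂) * (b₃ * c₁ - b₁ * c₃) +
        (a₃ * c₁ - a₁ * c₃) * (b₂ * c₁ - b₁ * c₂)) * g y z x := by
  rw [← hg.polar_self_right]
  simp only [hg.polar_add, hg.polar_smul, hg.polar_add₂, hg.polar_smul₂, hg.polar_add₃,
    hg.polar_smul₃, hg.polar_add₄, hg.polar_smul₄]
  simp only [hg.polar_self_right, hg.polar_self_left, hg.polar_cross₁₃, hg.polar_cross₁₄,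
    hg.polar_cross₂₃, hg.polar_cross₂₄, hg.self_left, hg.self_right, hg.symm_left y x,
    hg.symm_left z x, hg.symm_left z y, hg.symm_swap y x, hg.symm_swap z x, hg.symm_swap z y]
  ring

end Is2InnerProduct

/-- Lemma 2 (2)-(3) of the paper: expansion of a 2-inner product on linear
combinations of two, respectively three, vectors. -/
theorem two_inner_expansion
    (V : Type*) [AddCommGroup V] [Module ℝ V] (g : V → V → V → ℝ)
    (hg : Is2InnerProduct V g) :
    -- (a): two vectors
    (∀ (e₁ e₂ : V) (α₁ α₂ β₁ β₂ γ₁ γ₂ : ℝ),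
      g (α₁ • e₁ + α₂ • e₂) (β₁ • e₁ + β₂ • e₂) (γ₁ • e₁ + γ₂ • e₂) =
        (α₁ * γ₂ - α₂ * γ₁) * (β₁ * γ₂ - β₂ * γ₁) * g e₁ e₁ e₂) ∧
    -- (b): three vectors
    (∀ (e : Fin 3 → V) (α β γ : Fin 3 → ℝ),
      g (∑ i, α i • e i) (∑ i, β i • e i) (∑ i, γ i • e i) =
        (1 / 2) * (∑ i, ∑ j,
          if i ≠ j then
            (α i * γ j - α j * γ i) * (β i * γ j - β j * γ i) * g (e i) (e i) (e j)
          else 0) +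
        (∑ i, ∑ j, ∑ k,
          if i ≠ j ∧ j ≠ k ∧ i ≠ k then
            (α i * γ k - α k * γ i) * (β j * γ k - β k * γ j) * g (e i) (e j) (e k)
          else 0)) := by
  refine ⟨fun x y a₁ a₂ b₁ b₂ c₁ c₂ => ?_, fun e α β γ => ?_⟩
  · simpa using hg.expand_three x y 0 a₁ a₂ 0 b₁ b₂ 0 c₁ c₂ 0
  · simp only [Fin.sum_univ_three, hg.expand_three]
    simp [hg.symm_left (e 1) (e 0), hg.symm_left (e 2) (e 0), hg.symm_left (e 2) (e 1),
      hg.symm_swap (e 1) (e 0), hg.symm_swap (e 2) (e 0), hg.symm_swap (e 2) (e 1)]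
    ring
end

section
/- Let Ω ⊂ ℝ³ be a nonempty connected open set and let μ : Ω → ℝ be a positive, non-constant, C^∞ function. Suppose there exists a C^∞ map f : Ω → ℝ³ whose Jacobian determinant J(x,f) := det Df(x) is nonzero at every x ∈ Ω and which satisfies Df(x)ᵀ · Df(x) = J(x,f)² · μ(x) · I for all x ∈ Ω, where I is the 3×3 identity matrix. Then there exist r > 0 and a ∈ ℝ³ ∖ Ω such that μ(x) = (‖x−a‖⁴ / r⁴)² for all x ∈ Ω. -/
open scoped Matrix

noncomputable section

/-- The Jacobian matrix `Df(x)` of `f : ℝ³ → ℝ³` at `x`: the `(i,j)` entry is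
`∂f^i/∂x^j (x)`. -/
def jacMatrix (f : EuclideanSpace ℝ (Fin 3) → EuclideanSpace ℝ (Fin 3))
    (x : EuclideanSpace ℝ (Fin 3)) : Matrix (Fin 3) (Fin 3) ℝ :=
  Matrix.of fun i j => fderiv ℝ (fun y => f y i) x (EuclideanSpace.single j 1)

section LiouvilleConformal

open scoped RealInnerProductSpace

section PartialDeriv

variable {ι : Type*} [Fintype ι] [DecidableEq ι] {V : Type*} [NormedAddCommGroup V]
  [InnerProductSpace ℝ V]

/-- The `i`-th partial derivative. -/
def partialDeriv (i : ι) (g : EuclideanSpace ℝ ι → V) (x : EuclideanSpace ℝ ι) : V :=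
  fderiv ℝ g x (EuclideanSpace.single i 1)

theorem ContDiffOn.partialDeriv {Ω : Set (EuclideanSpace ℝ ι)} {g : EuclideanSpace ℝ ι → V}
    (hg : ContDiffOn ℝ (⊤ : ℕ∞) g Ω) (hΩ : IsOpen Ω) (i : ι) :
    ContDiffOn ℝ (⊤ : ℕ∞) (partialDeriv i g) Ω :=
  (hg.fderiv_of_isOpen hΩ (m := (⊤ : ℕ∞)) (by simp)).clm_apply contDiffOn_const

omit [DecidableEq ι] in
theorem ContDiffOn.differentiableAt_of_isOpen {Ω : Set (EuclideanSpace ℝ ι)}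
    {g : EuclideanSpace ℝ ι → V} (hg : ContDiffOn ℝ (⊤ : ℕ∞) g Ω) (hΩ : IsOpen Ω)
    {x : EuclideanSpace ℝ ι} (hx : x ∈ Ω) : DifferentiableAt ℝ g x :=
  (hg.contDiffAt (hΩ.mem_nhds hx)).differentiableAt (by simp)

theorem partialDeriv_comm {Ω : Set (EuclideanSpace ℝ ι)} {g : EuclideanSpace ℝ ι → V}
    (hg : ContDiffOn ℝ (⊤ : ℕ∞) g Ω) (hΩ : IsOpen Ω) {x : EuclideanSpace ℝ ι} (hx : x ∈ Ω)
    (i j : ι) : partialDeriv i (partialDeriv j g) x = partialDeriv j (partialDeriv i g) x := by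
  have hsymm := (hg.contDiffAt (hΩ.mem_nhds hx)).isSymmSndFDerivAt (by
    rw [minSmoothness_of_isRCLikeNormedField]
    exact WithTop.coe_le_coe.mpr (le_top : (2 : ℕ∞) ≤ ⊤))
  have hd : DifferentiableAt ℝ (fderiv ℝ g) x :=
    ((hg.fderiv_of_isOpen hΩ (m := (⊤ : ℕ∞)) (by simp)).contDiffAt
      (hΩ.mem_nhds hx)).differentiableAt (by simp)
  have key (k l : ι) : partialDeriv k (partialDeriv l g) x =
      fderiv ℝ (fderiv ℝ g) x (EuclideanSpace.single k 1) (EuclideanSpace.single l 1) := by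
    change fderiv ℝ (fun y => fderiv ℝ g y (EuclideanSpace.single l 1)) x _ = _
    rw [fderiv_clm_apply hd (by fun_prop)]
    simp
  rw [key, key]
  exact hsymm _ _

omit [Fintype ι] in
theorem partialDeriv_congr {Ω : Set (EuclideanSpace ℝ ι)} (hΩ : IsOpen Ω)
    {g h : EuclideanSpace ℝ ι → V} (hgh : Set.EqOn g h Ω) {x : EuclideanSpace ℝ ι} (hx : x ∈ Ω)
    (i : ι) : partialDeriv i g x = partialDeriv i h x := by
  rw [partialDeriv, partialDeriv,
    (Filter.eventuallyEq_of_mem (hΩ.mem_nhds hx) hgh).fderiv_eq]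

theorem partialDeriv_smul {c : EuclideanSpace ℝ ι → ℝ} {g : EuclideanSpace ℝ ι → V}
    {x : EuclideanSpace ℝ ι} (hc : DifferentiableAt ℝ c x) (hg : DifferentiableAt ℝ g x) (i : ι) :
    partialDeriv i (fun y => c y • g y) x = c x • partialDeriv i g x + partialDeriv i c x • g x := by
  simp [partialDeriv, fderiv_fun_smul hc hg]

theorem partialDeriv_mul {c g : EuclideanSpace ℝ ι → ℝ}
    {x : EuclideanSpace ℝ ι} (hc : DifferentiableAt ℝ c x) (hg : DifferentiableAt ℝ g x) (i : ι) :
    partialDeriv i (fun y => c y * g y) x = c x * partialDeriv i g x + partialDeriv i c x * g x :=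
  partialDeriv_smul hc hg i

theorem partialDeriv_exp {c : EuclideanSpace ℝ ι → ℝ} {x : EuclideanSpace ℝ ι}
    (hc : DifferentiableAt ℝ c x) (i : ι) :
    partialDeriv i (fun y => Real.exp (c y)) x = Real.exp (c x) * partialDeriv i c x := by
  simp [partialDeriv, fderiv_exp hc]

theorem partialDeriv_inner {g h : EuclideanSpace ℝ ι → V} {x : EuclideanSpace ℝ ι}
    (hg : DifferentiableAt ℝ g x) (hh : DifferentiableAt ℝ h x) (i : ι) :
    partialDeriv i (fun y => ⟪g y, h y⟫) x =
      ⟪g x, partialDeriv i h x⟫ + ⟪partialDeriv i g x, h x⟫ := 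
  fderiv_inner_apply ℝ hg hh _

omit [Fintype ι] in
theorem partialDeriv_const (c : V) (x : EuclideanSpace ℝ ι) (i : ι) :
    partialDeriv i (fun _ => c) x = 0 := by
  simp [partialDeriv]

omit [Fintype ι] in
theorem partialDeriv_ite_zero (p : Prop) [Decidable p] (g : EuclideanSpace ℝ ι → V)
    (x : EuclideanSpace ℝ ι) (i : ι) :
    partialDeriv i (fun y => if p then g y else 0) x = if p then partialDeriv i g x else 0 := by
  split_ifs
  · rfl
  · exact partialDeriv_const 0 x i

theorem partialDeriv_sub {g h : EuclideanSpace ℝ ι → V} {x : EuclideanSpace ℝ ι}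
    (hg : DifferentiableAt ℝ g x) (hh : DifferentiableAt ℝ h x) (i : ι) :
    partialDeriv i (fun y => g y - h y) x = partialDeriv i g x - partialDeriv i h x := by
  simp [partialDeriv, fderiv_fun_sub hg hh]

theorem partialDeriv_sum {κ : Type*} {s : Finset κ} {g : κ → EuclideanSpace ℝ ι → V}
    {x : EuclideanSpace ℝ ι} (hg : ∀ k ∈ s, DifferentiableAt ℝ (g k) x) (i : ι) :
    partialDeriv i (fun y => ∑ k ∈ s, g k y) x = ∑ k ∈ s, partialDeriv i (g k) x := by
  simp [partialDeriv, fderiv_fun_sum hg]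

theorem partialDeriv_const_mul_coord (c : ℝ) (i j : ι) (x : EuclideanSpace ℝ ι) :
    partialDeriv j (fun y => c * y i) x = if i = j then c else 0 := by
  have h : HasFDerivAt (fun y : EuclideanSpace ℝ ι => c * y i)
      (c • (EuclideanSpace.proj i : EuclideanSpace ℝ ι →L[ℝ] ℝ)) x :=
    (EuclideanSpace.proj (𝕜 := ℝ) i).hasFDerivAt.const_mul c
  simp [partialDeriv, h.fderiv]

theorem exists_eq_const_of_partialDeriv_eq_zero {Ω : Set (EuclideanSpace ℝ ι)} (hΩ : IsOpen Ω)
    (hconn : IsConnected Ω) {g : EuclideanSpace ℝ ι → V} (hg : ContDiffOn ℝ (⊤ : ℕ∞) g Ω)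
    (h : ∀ x ∈ Ω, ∀ i, partialDeriv i g x = 0) : ∃ c, ∀ x ∈ Ω, g x = c := by
  refine hΩ.exists_is_const_of_fderiv_eq_zero hconn.isPreconnected
    (hg.differentiableOn (by simp)) fun x hx => ?_
  refine ContinuousLinearMap.coe_injective ((EuclideanSpace.basisFun ι ℝ).toBasis.ext fun i => ?_)
  simpa [partialDeriv] using h x hx i

section Frame

variable {Ω : Set (EuclideanSpace ℝ ι)} {u : EuclideanSpace ℝ ι → ℝ}
  {f : EuclideanSpace ℝ ι → EuclideanSpace ℝ ι}

/-- The frame `exp u · ∂ᵢ f`. -/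
def scaledFrame (u : EuclideanSpace ℝ ι → ℝ) (f : EuclideanSpace ℝ ι → V) (i : ι)
    (x : EuclideanSpace ℝ ι) : V :=
  Real.exp (u x) • partialDeriv i f x

theorem ContDiffOn.scaledFrame {f : EuclideanSpace ℝ ι → V} (hu : ContDiffOn ℝ (⊤ : ℕ∞) u Ω)
    (hf : ContDiffOn ℝ (⊤ : ℕ∞) f Ω) (hΩ : IsOpen Ω) (i : ι) :
    ContDiffOn ℝ (⊤ : ℕ∞) (scaledFrame u f i) Ω :=
  hu.exp.smul (hf.partialDeriv hΩ i)

theorem partialDeriv_scaledFrame_sub {f : EuclideanSpace ℝ ι → V} (hΩ : IsOpen Ω)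
    (hu : ContDiffOn ℝ (⊤ : ℕ∞) u Ω)
    (hf : ContDiffOn ℝ (⊤ : ℕ∞) f Ω) {x : EuclideanSpace ℝ ι} (hx : x ∈ Ω) (i k : ι) :
    partialDeriv k (scaledFrame u f i) x - partialDeriv k u x • scaledFrame u f i x =
      partialDeriv i (scaledFrame u f k) x - partialDeriv i u x • scaledFrame u f k x := by
  have key (i k : ι) : partialDeriv k (scaledFrame u f i) x =
      Real.exp (u x) • partialDeriv k (partialDeriv i f) x +
        partialDeriv k u x • scaledFrame u f i x := by
    have hux := hu.differentiableAt_of_isOpen hΩ hx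
    unfold scaledFrame
    rw [partialDeriv_smul hux.exp ((hf.partialDeriv hΩ i).differentiableAt_of_isOpen hΩ hx),
      partialDeriv_exp hux, smul_smul, mul_comm]
  rw [key, key, partialDeriv_comm hf hΩ hx k i]
  abel

/-- The connection coefficients of the frame `exp u · ∂ᵢ f`, when it is orthonormal. -/
theorem inner_partialDeriv_scaledFrame {f : EuclideanSpace ℝ ι → V} (hΩ : IsOpen Ω)
    (hu : ContDiffOn ℝ (⊤ : ℕ∞) u Ω) (hf : ContDiffOn ℝ (⊤ : ℕ∞) f Ω)
    (horth : ∀ x ∈ Ω, Orthonormal ℝ (scaledFrame u f · x)) {x : EuclideanSpace ℝ ι} (hx : x ∈ Ω)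
    (i j k : ι) :
    ⟪partialDeriv k (scaledFrame u f i) x, scaledFrame u f j x⟫ =
      (if i = k then partialDeriv j u x else 0) - (if j = k then partialDeriv i u x else 0) := by
  have hin (i j : ι) (y) (hy : y ∈ Ω) : ⟪scaledFrame u f i y, scaledFrame u f j y⟫ =
      if i = j then (1 : ℝ) else 0 := orthonormal_iff_ite.mp (horth y hy) i j
  have hd (i : ι) := (hu.scaledFrame hf hΩ i).differentiableAt_of_isOpen hΩ hx
  have hanti (i j k : ι) : ⟪partialDeriv k (scaledFrame u f i) x, scaledFrame u f j x⟫ =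
      -⟪partialDeriv k (scaledFrame u f j) x, scaledFrame u f i x⟫ := by
    have h := partialDeriv_congr hΩ (hin i j) hx k
    rw [partialDeriv_inner (hd i) (hd j), partialDeriv_const,
      real_inner_comm] at h
    linarith
  have hsymm (i j k : ι) : ⟪partialDeriv k (scaledFrame u f i) x, scaledFrame u f j x⟫ -
        (if i = j then partialDeriv k u x else 0) =
      ⟪partialDeriv i (scaledFrame u f k) x, scaledFrame u f j x⟫ -
        (if k = j then partialDeriv i u x else 0) := by
    have h := congrArg (⟪·, scaledFrame u f j x⟫) (partialDeriv_scaledFrame_sub hΩ hu hf hx i k)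
    simpa [inner_sub_left, real_inner_smul_left, hin _ _ x hx] using h
  have h1 := hsymm i j k
  have h2 := hsymm j k i
  have h3 := hsymm k i j
  have a1 := hanti i j k
  have a2 := hanti j k i
  have a3 := hanti k i j
  simp only [eq_comm (a := k) (b := j), eq_comm (a := j) (b := i), eq_comm (a := k) (b := i)]
    at h1 h2 h3
  linarith

/-- The flatness of the target metric, expressed through the conformal factor. -/
theorem curvature_identity (hΩ : IsOpen Ω)
    (hu : ContDiffOn ℝ (⊤ : ℕ∞) u Ω) (hf : ContDiffOn ℝ (⊤ : ℕ∞) f Ω)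
    (horth : ∀ x ∈ Ω, Orthonormal ℝ (scaledFrame u f · x)) {x : EuclideanSpace ℝ ι} (hx : x ∈ Ω)
    (i j k l : ι) :
    let Γ : ι → ι → ι → ℝ := fun i j k =>
      (if i = k then partialDeriv j u x else 0) - (if j = k then partialDeriv i u x else 0)
    let H : ι → ι → ℝ := fun i l => partialDeriv l (partialDeriv i u) x
    (if i = k then H j l else 0) - (if j = k then H i l else 0) - ∑ m, Γ i m k * Γ j m l =
      (if i = l then H j k else 0) - (if j = l then H i k else 0) - ∑ m, Γ i m l * Γ j m k := by
  intro Γ H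
  set e := scaledFrame u f with he
  have hΓ (y) (hy : y ∈ Ω) (i j k : ι) := inner_partialDeriv_scaledFrame hΩ hu hf horth hy i j k
  have hes (i : ι) : ContDiffOn ℝ (⊤ : ℕ∞) (e i) Ω := hu.scaledFrame hf hΩ i
  have hud (i : ι) := (hu.partialDeriv hΩ i).differentiableAt_of_isOpen hΩ hx
  have hpars (v w : EuclideanSpace ℝ ι) : ⟪v, w⟫ = ∑ m, ⟪v, e m x⟫ * ⟪w, e m x⟫ := by
    have : Nonempty ι := ⟨i⟩
    let b := (basisOfOrthonormalOfCardEqFinrank (horth x hx) (by simp)).toOrthonormalBasis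
      (by simpa using horth x hx)
    have := b.sum_inner_mul_inner v w
    simpa [b, real_inner_comm w] using this.symm
  have key (k l : ι) : ⟪partialDeriv l (partialDeriv k (e i)) x, e j x⟫ =
      (if i = k then H j l else 0) - (if j = k then H i l else 0) - ∑ m, Γ i m k * Γ j m l := by
    have h := partialDeriv_congr hΩ (fun y hy => hΓ y hy i j k) hx l
    rw [partialDeriv_inner (((hes i).partialDeriv hΩ k).differentiableAt_of_isOpen hΩ hx)
      ((hes j).differentiableAt_of_isOpen hΩ hx), hpars (partialDeriv k _ x)] at h
    simp only [hΓ x hx, e] at h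
    rw [he, eq_sub_iff_add_eq']
    refine h.trans ?_
    rw [partialDeriv_sub (by split_ifs <;> simp [hud]) (by split_ifs <;> simp [hud]),
      partialDeriv_ite_zero, partialDeriv_ite_zero]
  rw [← key k l, ← key l k, partialDeriv_comm (hes i) hΩ hx]

end Frame

end PartialDeriv

/-- In dimension three the Hessian of the logarithm of a conformal factor is determined by its
gradient. -/
theorem hessian_eq_of_orthonormal_scaledFrame {Ω : Set (EuclideanSpace ℝ (Fin 3))}
    {u : EuclideanSpace ℝ (Fin 3) → ℝ}
    {f : EuclideanSpace ℝ (Fin 3) → EuclideanSpace ℝ (Fin 3)} (hΩ : IsOpen Ω)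
    (hu : ContDiffOn ℝ (⊤ : ℕ∞) u Ω) (hf : ContDiffOn ℝ (⊤ : ℕ∞) f Ω)
    (horth : ∀ x ∈ Ω, Orthonormal ℝ (scaledFrame u f · x)) {x : EuclideanSpace ℝ (Fin 3)}
    (hx : x ∈ Ω) (i j : Fin 3) :
    partialDeriv j (partialDeriv i u) x = -(partialDeriv i u x * partialDeriv j u x) +
      if i = j then (∑ k, partialDeriv k u x ^ 2) / 2 else 0 := by
  have hR := curvature_identity hΩ hu hf horth hx
  have h01 := hR 0 1 0 1
  have h02 := hR 0 2 0 2
  have h12 := hR 1 2 1 2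
  have k0 := hR 0 1 0 2
  have k1 := hR 1 0 1 2
  have k2 := hR 2 0 2 1
  have c01 := partialDeriv_comm hu hΩ hx 0 1
  have c02 := partialDeriv_comm hu hΩ hx 0 2
  have c12 := partialDeriv_comm hu hΩ hx 1 2
  simp [Fin.sum_univ_three] at h01 h02 h12 k0 k1 k2
  fin_cases i <;> fin_cases j <;> simp [Fin.sum_univ_three] <;> linarith

/-- A positive function `exp u` whose logarithm satisfies the Hessian equation of a flat conformal
metric is either constant or a multiple of the squared distance to a point. -/
theorem exp_eq_mul_norm_sq_of_hessian_eq {ι : Type*} [Fintype ι] [DecidableEq ι]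
    {Ω : Set (EuclideanSpace ℝ ι)} {u : EuclideanSpace ℝ ι → ℝ} (hΩ : IsOpen Ω)
    (hconn : IsConnected Ω) (hu : ContDiffOn ℝ (⊤ : ℕ∞) u Ω)
    (hnonconst : ¬ ∃ c, ∀ x ∈ Ω, u x = c)
    (hH : ∀ x ∈ Ω, ∀ i j, partialDeriv j (partialDeriv i u) x =
      -(partialDeriv i u x * partialDeriv j u x) +
        if i = j then (∑ k, partialDeriv k u x ^ 2) / 2 else 0) :
    ∃ s : ℝ, 0 < s ∧ ∃ a, ∀ x ∈ Ω, Real.exp (u x) = s * ‖x - a‖ ^ 2 := by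
  have hdu (x) (hx : x ∈ Ω) := hu.differentiableAt_of_isOpen hΩ hx
  have hdp (i : ι) (x) (hx : x ∈ Ω) := (hu.partialDeriv hΩ i).differentiableAt_of_isOpen hΩ hx
  obtain ⟨σ, hσ⟩ : ∃ σ, ∀ x ∈ Ω,
      Real.exp (u x) * ∑ k, partialDeriv k u x * partialDeriv k u x = σ := by
    refine exists_eq_const_of_partialDeriv_eq_zero hΩ hconn
      (hu.exp.mul (ContDiffOn.sum fun k _ => (hu.partialDeriv hΩ k).mul (hu.partialDeriv hΩ k)))
      fun x hx j => ?_
    have hdm (k : ι) (_ : k ∈ Finset.univ) :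
        DifferentiableAt ℝ (fun y => partialDeriv k u y * partialDeriv k u y) x := (hdp k x hx).mul (hdp k x hx)
    rw [partialDeriv_mul (hdu x hx).exp (DifferentiableAt.fun_sum hdm),
      partialDeriv_exp (hdu x hx), partialDeriv_sum hdm]
    have hterm (k : ι) : partialDeriv j (fun y => partialDeriv k u y * partialDeriv k u y) x =
        -2 * partialDeriv j u x * (partialDeriv k u x ^ 2) +
          if k = j then partialDeriv k u x * (∑ k, partialDeriv k u x ^ 2) else 0 := by
      rw [partialDeriv_mul (hdp k x hx) (hdp k x hx), hH x hx]
      split_ifs <;> ring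
    simp only [hterm, Finset.sum_add_distrib, ← Finset.mul_sum, Finset.sum_ite_eq',
      Finset.mem_univ, if_true]
    simp only [← pow_two]
    ring
  have hgrad (i : ι) : ∃ b, ∀ x ∈ Ω,
      Real.exp (u x) * partialDeriv i u x - σ / 2 * x i = b := by
    refine exists_eq_const_of_partialDeriv_eq_zero hΩ hconn
      ((hu.exp.mul (hu.partialDeriv hΩ i)).sub (by fun_prop)) fun x hx j => ?_
    rw [partialDeriv_sub ((hdu x hx).exp.fun_mul (hdp i x hx)) (by fun_prop),
      partialDeriv_mul (hdu x hx).exp (hdp i x hx), partialDeriv_exp (hdu x hx), hH x hx,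
      partialDeriv_const_mul_coord, ← hσ x hx]
    simp only [← pow_two]
    split_ifs <;> ring
  choose b hb using hgrad
  have hσ0 : σ ≠ 0 := by
    rintro rfl
    refine hnonconst (exists_eq_const_of_partialDeriv_eq_zero hΩ hconn hu fun x hx i => ?_)
    have h := (mul_eq_zero.mp (hσ x hx)).resolve_left (Real.exp_ne_zero _)
    exact mul_self_eq_zero.mp
      ((Finset.sum_eq_zero_iff_of_nonneg fun k _ => mul_self_nonneg _).mp h i (Finset.mem_univ i))
  have hσpos : 0 < σ := by
    obtain ⟨x, hx⟩ := hconn.nonempty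
    refine lt_of_le_of_ne ?_ hσ0.symm
    rw [← hσ x hx]
    exact mul_nonneg (Real.exp_pos _).le (Finset.sum_nonneg fun k _ => mul_self_nonneg _)
  refine ⟨σ / 4, by positivity, WithLp.toLp 2 fun i => -(2 / σ) * b i, fun x hx => ?_⟩
  have hcoord (i : ι) : (x i - -(2 / σ) * b i) ^ 2 =
      4 / σ ^ 2 * Real.exp (u x) ^ 2 * (partialDeriv i u x * partialDeriv i u x) := by
    rw [← hb i x hx]
    field_simp
    ring
  rw [EuclideanSpace.norm_sq_eq]
  simp only [PiLp.sub_apply, Real.norm_eq_abs, sq_abs, hcoord, ← Finset.mul_sum]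
  have := hσ x hx
  generalize ∑ k, partialDeriv k u x * partialDeriv k u x = S at this ⊢
  field_simp
  linear_combination -this

theorem jacMatrix_transpose_mul_self_apply
    {f : EuclideanSpace ℝ (Fin 3) → EuclideanSpace ℝ (Fin 3)} {x : EuclideanSpace ℝ (Fin 3)}
    (hf : DifferentiableAt ℝ f x) (i j : Fin 3) :
    ((jacMatrix f x)ᵀ * jacMatrix f x) i j = ⟪partialDeriv i f x, partialDeriv j f x⟫ := by
  have h (k l : Fin 3) : fderiv ℝ (fun y => f y k) x (EuclideanSpace.single l 1) =
      partialDeriv l f x k := by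
    have := ((EuclideanSpace.proj (𝕜 := ℝ) k).hasFDerivAt.comp x hf.hasFDerivAt).fderiv
    exact congrArg (· (EuclideanSpace.single l 1)) this
  simp [Matrix.mul_apply, jacMatrix, h, PiLp.inner_apply, mul_comm]

end LiouvilleConformal

/-- Lemma 4 of the paper: if `μ` is a positive non-constant smooth function on a nonempty
connected open set `Ω ⊆ ℝ³` and the PDE `Df(x)ᵀ · Df(x) = J(x,f)² · μ(x) · I` has a `C^∞`
solution `f` with everywhere nonzero Jacobian determinant, then
`μ(x) = (‖x − a‖⁴ / r⁴)²` for some `r > 0` and some `a ∉ Ω`. -/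
theorem mu_of_beltrami_solution
    (Ω : Set (EuclideanSpace ℝ (Fin 3))) (hΩ : IsOpen Ω) (hconn : IsConnected Ω)
    (μ : EuclideanSpace ℝ (Fin 3) → ℝ)
    (hμsmooth : ContDiffOn ℝ (⊤ : ℕ∞) μ Ω)
    (hμpos : ∀ x ∈ Ω, 0 < μ x)
    (hμnonconst : ¬ ∃ c : ℝ, ∀ x ∈ Ω, μ x = c)
    (f : EuclideanSpace ℝ (Fin 3) → EuclideanSpace ℝ (Fin 3))
    (hfsmooth : ContDiffOn ℝ (⊤ : ℕ∞) f Ω)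
    (hJ : ∀ x ∈ Ω, (jacMatrix f x).det ≠ 0)
    (hPDE : ∀ x ∈ Ω,
      (jacMatrix f x)ᵀ * jacMatrix f x =
        ((jacMatrix f x).det ^ 2 * μ x) • (1 : Matrix (Fin 3) (Fin 3) ℝ)) :
    ∃ r : ℝ, 0 < r ∧ ∃ a : EuclideanSpace ℝ (Fin 3), a ∉ Ω ∧
      ∀ x ∈ Ω, μ x = (‖x - a‖ ^ 4 / r ^ 4) ^ 2 := by
  classical
  set u : EuclideanSpace ℝ (Fin 3) → ℝ := fun x => Real.log (μ x) / 4 with hu_def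
  have hμexp (x) (hx : x ∈ Ω) : μ x = Real.exp (u x) ^ 4 := by
    rw [← Real.exp_nat_mul, hu_def]
    simp [mul_div_cancel₀, Real.exp_log (hμpos x hx)]
  have hu : ContDiffOn ℝ (⊤ : ℕ∞) u Ω :=
    (hμsmooth.log fun x hx => (hμpos x hx).ne').div_const 4
  have horth (x) (hx : x ∈ Ω) : Orthonormal ℝ (scaledFrame u f · x) := by
    have hscale : Real.exp (u x) ^ 2 * ((jacMatrix f x).det ^ 2 * μ x) = 1 := by
      have hdet := congrArg Matrix.det (hPDE x hx)
      rw [Matrix.det_mul, Matrix.det_transpose, Matrix.det_smul, Matrix.det_one,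
        Fintype.card_fin] at hdet
      have hD : (jacMatrix f x).det ^ 4 * μ x ^ 3 = 1 :=
        mul_left_cancel₀ (pow_ne_zero 2 (hJ x hx)) (by linear_combination -hdet)
      refine (pow_eq_one_iff_of_nonneg
        (mul_nonneg (by positivity) (mul_nonneg (by positivity) (hμpos x hx).le))
        two_ne_zero).mp ?_
      rw [← hD, mul_pow, ← pow_mul, ← hμexp x hx]
      ring
    refine orthonormal_iff_ite.mpr fun i j => ?_
    have hij := congrFun₂ (hPDE x hx) i j
    rw [jacMatrix_transpose_mul_self_apply (hfsmooth.differentiableAt_of_isOpen hΩ hx)] at hij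
    rw [scaledFrame, scaledFrame, real_inner_smul_left, real_inner_smul_right, hij,
      Matrix.smul_apply, Matrix.one_apply, smul_eq_mul, ← mul_assoc, ← pow_two, ← mul_assoc,
      hscale, one_mul]
  obtain ⟨s, hs, a, ha⟩ := exp_eq_mul_norm_sq_of_hessian_eq hΩ hconn hu
    (fun ⟨c, hc⟩ => hμnonconst ⟨Real.exp c ^ 4, fun x hx => by rw [hμexp x hx, hc x hx]⟩)
    fun x hx => hessian_eq_of_orthonormal_scaledFrame hΩ hu hfsmooth horth hx
  refine ⟨(√s)⁻¹, by positivity, a, fun haΩ => ?_, fun x hx => ?_⟩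
  · have := ha a haΩ
    simp at this
  · have h4 : √s ^ 4 = s ^ 2 := by rw [show 4 = 2 * 2 from rfl, pow_mul, Real.sq_sqrt hs.le]
    rw [hμexp x hx, ha x hx, inv_pow, h4, div_inv_eq_mul]
    ring
end
end
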